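/- Let p = 1, 0 < q < 1, and let v, w be weights on (0,∞). Then there exists a positive constant C such that the two-weight Hardy inequality holds with constant C for every nonnegative measurable function f on (0,∞) if and only if ∫_0^∞ V(t)^{q/(1−q)} W(t)^{q/(1−q)} w(t) dt < ∞, where V(t) = ess sup_{s∈(0,t)} 1/v(s) and W(t) = ∫_t^∞ w. -/

import Mathlib

open MeasureTheory Set ENNReal

lemma antitone_measure_Ioi (ν : Measure ℝ) : Antitone fun t => ν (Ioi t) :=
  fun _ _ h => measure_mono (Ioi_subset_Ioi h)

lemma exists_measure_Ioi_eq {ν : Measure ℝ} (hW : Continuous fun t => ν (Ioi t)) {s t : ℝ} (hst : s ≤ t)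
    {c : ℝ≥0∞} (h1 : ν (Ioi t) ≤ c) (h2 : c ≤ ν (Ioi s)) :
    ∃ u ∈ Icc s t, ν (Ioi u) = c :=
  intermediate_value_Icc' hst hW.continuousOn ⟨h1, h2⟩

lemma measure_Ioc_add_measure_Ioi (ν : Measure ℝ) {s u : ℝ} (h : s ≤ u) :
    ν (Ioc s u) + ν (Ioi u) = ν (Ioi s) := by
  rw [← Ioc_union_Ioi_eq_Ioi h, measure_union _ measurableSet_Ioi]
  rw [disjoint_left]
  intro x hx hx'
  exact absurd hx.2 (not_le.2 hx')

lemma measure_Ioc_of_measure_Ioi_eq_half {ν : Measure ℝ} [IsFiniteMeasure ν] {s u : ℝ} (h : s ≤ u)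
    (hu : ν (Ioi u) = ν (Ioi s) / 2) : ν (Ioc s u) = ν (Ioi s) / 2 := by
  have h1 := measure_Ioc_add_measure_Ioi ν h
  rw [hu] at h1
  have h2 : ν (Ioi s) / 2 ≠ ⊤ := (ENNReal.div_lt_top (measure_ne_top _ _) (by simp)).ne
  rw [← ENNReal.add_halves (ν (Ioi s))] at h1
  simp only [ENNReal.add_halves] at h1
  exact (ENNReal.add_left_inj h2).1 (h1.trans (ENNReal.add_halves _).symm)

lemma measure_setOf_measure_Ioi_le {ν : Measure ℝ} [NullSingletonClass ν]
    (hW : Continuous fun t => ν (Ioi t)) (h0 : ν (Iic 0) = 0) (M : ℝ≥0∞) :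
    ν {t | ν (Ioi t) ≤ M} ≤ M := by
  set S : Set ℝ := {t | ν (Ioi t) ≤ M} ∩ Ici 0 with hS
  have hsub : {t | ν (Ioi t) ≤ M} ⊆ Iic 0 ∪ S := by
    intro t ht
    rcases le_total t 0 with h | h
    · exact Or.inl h
    · exact Or.inr ⟨ht, h⟩
  refine (measure_mono hsub).trans ((measure_union_le _ _).trans ?_)
  rw [h0, zero_add]
  rcases S.eq_empty_or_nonempty with he | hne
  · simp [he]
  have hcl : IsClosed S := (isClosed_le hW continuous_const).inter isClosed_Ici
  have hbd : BddBelow S := ⟨0, fun x hx => hx.2⟩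
  have hmem := hcl.csInf_mem hne hbd
  calc ν S ≤ ν (Ici (sInf S)) := measure_mono fun x hx => csInf_le hbd hx
    _ = ν (Ioi (sInf S)) := (measure_congr Ioi_ae_eq_Ici).symm
    _ ≤ M := hmem.1

lemma mul_rpow_le_add_setLIntegral {ν : Measure ℝ} [IsFiniteMeasure ν]
    (hW : Continuous fun t => ν (Ioi t)) {α : ℝ} (hα : 0 < α)
    {V : ℝ → ℝ≥0∞} (hV : Monotone V) {s t : ℝ} (hst : s ≤ t) :
    (V s * ν (Ioi s)) ^ α * (2⁻¹ ^ α * 2⁻¹) ≤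
      (V t * ν (Ioi t)) ^ α + ∫⁻ r in Iic t, (V r * ν (Ioi r)) ^ α * (ν (Ioi r))⁻¹ ∂ν := by
  have hfin : ν (Ioi s) ≠ ⊤ := measure_ne_top _ _
  rcases eq_or_ne (ν (Ioi s)) 0 with hz | hz
  · simp [hz, ENNReal.zero_rpow_of_pos hα]
  rcases le_total (ν (Ioi s) / 2) (ν (Ioi t)) with h | h
  · refine le_add_right ?_
    calc (V s * ν (Ioi s)) ^ α * (2⁻¹ ^ α * 2⁻¹)
        ≤ (V s * ν (Ioi s)) ^ α * (2⁻¹ ^ α * 1) := by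
          gcongr; simp
      _ = (V s * (ν (Ioi s) / 2)) ^ α := by
          rw [mul_one, ← ENNReal.mul_rpow_of_nonneg _ _ hα.le, mul_assoc, div_eq_mul_inv]
      _ ≤ _ := by
          gcongr
          exact hV hst
  · refine le_add_left ?_
    obtain ⟨u, hu, hu'⟩ := exists_measure_Ioi_eq hW hst h ENNReal.half_le_self
    have hm := measure_Ioc_of_measure_Ioi_eq_half hu.1 hu'
    calc (V s * ν (Ioi s)) ^ α * (2⁻¹ ^ α * 2⁻¹)
        = (V s * (ν (Ioi s) / 2)) ^ α * 2⁻¹ := by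
          rw [← mul_assoc, ← ENNReal.mul_rpow_of_nonneg _ _ hα.le, mul_assoc, div_eq_mul_inv]
      _ = (V s * (ν (Ioi s) / 2)) ^ α * ((ν (Ioi s))⁻¹ * ν (Ioc s u)) := by
          rw [hm, div_eq_mul_inv (ν (Ioi s)), ← mul_assoc (ν (Ioi s))⁻¹,
            ENNReal.inv_mul_cancel hz hfin, one_mul]
      _ = ∫⁻ r in Ioc s u, (V s * (ν (Ioi s) / 2)) ^ α * (ν (Ioi s))⁻¹ ∂ν := by
          rw [setLIntegral_const, mul_assoc]
      _ ≤ ∫⁻ r in Ioc s u, (V r * ν (Ioi r)) ^ α * (ν (Ioi r))⁻¹ ∂ν := by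
          refine setLIntegral_mono' measurableSet_Ioc fun r hr => ?_
          gcongr
          · exact hV hr.1.le
          · rw [← hu']
            exact antitone_measure_Ioi ν hr.2
          · exact hr.1.le
      _ ≤ _ := lintegral_mono_set fun r hr => hr.2.trans hu.2

/-- The test density `V^{1+α} W^α` controls the weighted integral of `V^α W^α`. -/
lemma lintegral_mul_rpow_le {ν : Measure ℝ} [IsFiniteMeasure ν] [NullSingletonClass ν]
    (hW : Continuous fun t => ν (Ioi t))
    (h0 : ν (Iic 0) = 0) {N : ℝ} (hN : ν (Ioi N) = 0) {q α : ℝ} (hq : 0 < q) (hα : 0 < α)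
    (hqα : (1 + α) * q = α) {U : ℝ → ℝ≥0∞} (hU : Monotone U) :
    ∫⁻ t, (U t * ν (Ioi t)) ^ α ∂ν ≤
      2 ^ α * 4 * 4 * ∫⁻ x, (∫⁻ t in Iio x, U t ^ (1 + α) * ν (Ioi t) ^ α ∂ν) ^ q ∂ν := by
  have hWm : Measurable fun t => ν (Ioi t) := hW.measurable
  set H : ℝ → ℝ≥0∞ := fun x => ∫⁻ t in Iio x, U t ^ (1 + α) * ν (Ioi t) ^ α ∂ν with hH
  have hHmono : Monotone H := fun x y h => lintegral_mono_set (Iio_subset_Iio h)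
  have hHm : Measurable H := hHmono.measurable
  set P : Set (ℝ × ℝ) := {p | p.1 < p.2 ∧ ν (Ioi p.1) ≤ 4 * ν (Ioi p.2)} with hP
  have hPm : MeasurableSet P :=
    (measurableSet_lt measurable_fst measurable_snd).inter
      (measurableSet_le (hWm.comp measurable_fst) ((hWm.comp measurable_snd).const_mul 4))
  set k : ℝ → ℝ → ℝ≥0∞ := fun t x => P.indicator (fun p => (ν (Ioi p.1))⁻¹ * H p.2 ^ q) (t, x)
    with hk
  have hkm : Measurable (Function.uncurry k) := by
    have : Measurable fun p : ℝ × ℝ => (ν (Ioi p.1))⁻¹ * H p.2 ^ q :=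
      (hWm.comp measurable_fst).inv.mul ((hHm.comp measurable_snd).pow_const q)
    exact this.indicator hPm
  have pointwise : ∀ t, (U t * ν (Ioi t)) ^ α ≤ 2 ^ α * 4 * ∫⁻ x, k t x ∂ν := by
    intro t
    have hfin : ν (Ioi t) ≠ ⊤ := measure_ne_top _ _
    rcases eq_or_ne (ν (Ioi t)) 0 with hz | hz
    · simp [hz, ENNReal.zero_rpow_of_pos hα]
    have htN : t ≤ N := by
      by_contra h
      exact hz (measure_mono_null (Ioi_subset_Ioi (not_le.1 h).le) hN)
    obtain ⟨u, hu, hu'⟩ := exists_measure_Ioi_eq hW (c := ν (Ioi t) / 2) htN (by simp [hN])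
      ENNReal.half_le_self
    obtain ⟨y, hy, hy'⟩ := exists_measure_Ioi_eq hW (c := ν (Ioi u) / 2) hu.2 (by simp [hN])
      ENNReal.half_le_self
    have hm := measure_Ioc_of_measure_Ioi_eq_half hu.1 hu'
    have hm' := measure_Ioc_of_measure_Ioi_eq_half hy.1 hy'
    have hhalf0 : ν (Ioi t) / 2 ≠ 0 := by simp [hz]
    have hhalf : ν (Ioi t) / 2 ≠ ⊤ := (ENNReal.div_lt_top hfin (by simp)).ne
    have hHle : ∀ x, u < x → U t ^ α * (ν (Ioi t) / 2) ^ α ≤ H x ^ q := by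
      intro x hx
      have h1 : U t ^ (1 + α) * (ν (Ioi t) / 2) ^ (1 + α) ≤ H x := by
        calc U t ^ (1 + α) * (ν (Ioi t) / 2) ^ (1 + α)
            = U t ^ (1 + α) * (ν (Ioi t) / 2) ^ α * ν (Ioc t u) := by
              rw [add_comm 1 α, ENNReal.rpow_add α 1 hhalf0 hhalf, ENNReal.rpow_one, hm, mul_assoc]
          _ = ∫⁻ r in Ioc t u, U t ^ (1 + α) * (ν (Ioi t) / 2) ^ α ∂ν := by
              rw [setLIntegral_const]
          _ ≤ ∫⁻ r in Ioc t u, U r ^ (1 + α) * ν (Ioi r) ^ α ∂ν := by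
              refine setLIntegral_mono' measurableSet_Ioc fun r hr => ?_
              gcongr
              · exact hU hr.1.le
              · rw [← hu']
                exact antitone_measure_Ioi ν hr.2
          _ ≤ _ := lintegral_mono_set fun r hr => hr.2.trans_lt hx
      calc U t ^ α * (ν (Ioi t) / 2) ^ α = (U t ^ (1 + α) * (ν (Ioi t) / 2) ^ (1 + α)) ^ q := by
            rw [ENNReal.mul_rpow_of_nonneg _ _ hq.le, ← ENNReal.rpow_mul, ← ENNReal.rpow_mul, hqα]
        _ ≤ _ := by gcongr
    have hlow : (ν (Ioi t))⁻¹ * (U t ^ α * (ν (Ioi t) / 2) ^ α) * ν (Ioc u y) ≤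
        ∫⁻ x, k t x ∂ν := by
      rw [← setLIntegral_const]
      refine le_trans ?_ (setLIntegral_le_lintegral (Ioc u y) _)
      refine setLIntegral_mono' measurableSet_Ioc fun x hx => ?_
      have hmem : (t, x) ∈ P := by
        refine ⟨hu.1.trans_lt hx.1, ?_⟩
        have h2 : ν (Ioi t) / 2 / 2 ≤ ν (Ioi x) := by
          rw [← hu', ← hy']
          exact antitone_measure_Ioi ν hx.2
        calc ν (Ioi t) = 4 * (ν (Ioi t) / 2 / 2) := by
              rw [show (4 : ℝ≥0∞) = 2 * 2 by norm_num, mul_assoc,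
                ENNReal.mul_div_cancel (by simp) (by simp),
                ENNReal.mul_div_cancel (by simp) (by simp)]
          _ ≤ _ := by gcongr
      simp only [hk, indicator_of_mem hmem]
      gcongr
      exact hHle x hx.1
    have key : (U t * ν (Ioi t)) ^ α = 2 ^ α * 4 *
        ((ν (Ioi t))⁻¹ * (U t ^ α * (ν (Ioi t) / 2) ^ α) * ν (Ioc u y)) := by
      have e1 : (U t * ν (Ioi t)) ^ α = 2 ^ α * (U t ^ α * (ν (Ioi t) / 2) ^ α) := by
        rw [← ENNReal.mul_rpow_of_nonneg _ _ hα.le, ← ENNReal.mul_rpow_of_nonneg _ _ hα.le,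
          mul_left_comm, ENNReal.mul_div_cancel (by simp) (by simp)]
      have e2 : 4 * ν (Ioc u y) = ν (Ioi t) := by
        rw [hm', hu', show (4 : ℝ≥0∞) = 2 * 2 by norm_num, mul_assoc,
                ENNReal.mul_div_cancel (by simp) (by simp),
                ENNReal.mul_div_cancel (by simp) (by simp)]
      calc (U t * ν (Ioi t)) ^ α
          = 2 ^ α * (U t ^ α * (ν (Ioi t) / 2) ^ α) * ((ν (Ioi t))⁻¹ * (4 * ν (Ioc u y))) := by
            rw [e2, ENNReal.inv_mul_cancel hz hfin, mul_one, e1]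
        _ = _ := by ring
    rw [key]
    gcongr
  have inner : ∀ x, ∫⁻ t, k t x ∂ν ≤ 4 * H x ^ q := by
    intro x
    calc ∫⁻ t, k t x ∂ν
        ≤ ∫⁻ t, {t | ν (Ioi t) ≤ 4 * ν (Ioi x)}.indicator
            (fun _ => (ν (Ioi x))⁻¹ * H x ^ q) t ∂ν := by
          refine lintegral_mono fun t => ?_
          simp only [hk]
          by_cases h : (t, x) ∈ P
          · rw [indicator_of_mem h, indicator_of_mem (by exact h.2)]
            gcongr
            exact h.1.le
          · rw [indicator_of_notMem h]
            exact zero_le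
      _ = (ν (Ioi x))⁻¹ * H x ^ q * ν {t | ν (Ioi t) ≤ 4 * ν (Ioi x)} :=
          lintegral_indicator_const (measurableSet_le hWm measurable_const) _
      _ ≤ (ν (Ioi x))⁻¹ * H x ^ q * (4 * ν (Ioi x)) := by
          gcongr
          exact measure_setOf_measure_Ioi_le hW h0 _
      _ = 4 * H x ^ q * ((ν (Ioi x))⁻¹ * ν (Ioi x)) := by ring
      _ ≤ 4 * H x ^ q * 1 := by
          gcongr
          exact ENNReal.inv_mul_le_one _
      _ = _ := mul_one _
  calc ∫⁻ t, (U t * ν (Ioi t)) ^ α ∂ν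
      ≤ ∫⁻ t, 2 ^ α * 4 * ∫⁻ x, k t x ∂ν ∂ν := lintegral_mono pointwise
    _ = 2 ^ α * 4 * ∫⁻ t, ∫⁻ x, k t x ∂ν ∂ν :=
        lintegral_const_mul _ hkm.lintegral_prod_right'
    _ = 2 ^ α * 4 * ∫⁻ x, ∫⁻ t, k t x ∂ν ∂ν := by
        rw [lintegral_lintegral_swap hkm.aemeasurable]
    _ ≤ 2 ^ α * 4 * ∫⁻ x, 4 * H x ^ q ∂ν := by
        gcongr with x
        exact inner x
    _ = _ := by
        rw [lintegral_const_mul _ (hHm.pow_const q), ← mul_assoc]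


/-- Mass `h` can be redistributed to its left, near the essential supremum of `1 / v`. -/
lemma exists_lintegral_Iio_le {ρ ν : Measure ℝ} [SFinite ρ] [SFinite ν]
    (hρ : ∀ t, ρ (Iio t) ≠ ⊤) {v : ℝ → ℝ≥0∞} (hv : Measurable v) {U : ℝ → ℝ≥0∞}
    (hU : Monotone U) (hUV : ∀ t, U t ≤ essSup (fun s => (v s)⁻¹) (ρ.restrict (Iio t)))
    (hUtop : ∀ t, U t ≠ ⊤) {h : ℝ → ℝ≥0∞} (hh : Measurable h) (hh0 : ∀ t, U t = 0 → h t = 0) :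
    ∃ f : ℝ → ℝ≥0∞, Measurable f ∧ (∀ x, ∫⁻ t in Iio x, h t ∂ν ≤ ∫⁻ s in Iio x, f s ∂ρ) ∧
      ∫⁻ s, f s * v s ∂ρ ≤ 2 * ∫⁻ t, h t * (U t)⁻¹ ∂ν := by
  set S : Set (ℝ × ℝ) := {p | p.2 < p.1 ∧ U p.1 / 2 < (v p.2)⁻¹} with hS
  have hSm : MeasurableSet S :=
    (measurableSet_lt measurable_snd measurable_fst).inter
      (measurableSet_lt ((hU.measurable.comp measurable_fst).div_const 2)
        (hv.comp measurable_snd).inv)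
  set m : ℝ → ℝ≥0∞ := fun t => ρ (Prod.mk t ⁻¹' S) with hm
  have hmm : Measurable m := measurable_measure_prodMk_left hSm
  have hsec : ∀ t, MeasurableSet (Prod.mk t ⁻¹' S) := fun t => measurable_prodMk_left hSm
  have hmtop : ∀ t, m t ≠ ⊤ := fun t =>
    ((measure_mono fun s hs => hs.1).trans_lt (hρ t).lt_top).ne
  have hm0 : ∀ t, U t ≠ 0 → m t ≠ 0 := by
    intro t ht hmt
    have h1 : essSup (fun s => (v s)⁻¹) (ρ.restrict (Iio t)) ≤ U t / 2 := by
      refine essSup_le_of_ae_le _ ?_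
      change ∀ᵐ s ∂ρ.restrict (Iio t), (v s)⁻¹ ≤ U t / 2
      rw [ae_restrict_iff' measurableSet_Iio]
      have h2 : ∀ᵐ s ∂ρ, s ∉ Prod.mk t ⁻¹' S := measure_eq_zero_iff_ae_notMem.1 hmt
      filter_upwards [h2] with s hs hst
      by_contra hcon
      exact hs ⟨hst, not_le.1 hcon⟩
    exact absurd ((hUV t).trans h1) (not_le.2 (ENNReal.half_lt_self ht (hUtop t)))
  set k : ℝ → ℝ → ℝ≥0∞ := fun t s => S.indicator (fun p => h p.1 * (m p.1)⁻¹) (t, s) with hk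
  have hkm : Measurable (Function.uncurry k) := by
    have : Measurable fun p : ℝ × ℝ => h p.1 * (m p.1)⁻¹ :=
      (hh.comp measurable_fst).mul (hmm.comp measurable_fst).inv
    exact this.indicator hSm
  have hkS : ∀ t s, k t s = (Prod.mk t ⁻¹' S).indicator (fun _ => h t * (m t)⁻¹) s := by
    intro t s
    simp only [hk, indicator, mem_preimage]
  refine ⟨fun s => ∫⁻ t, k t s ∂ν, hkm.lintegral_prod_left', fun x => ?_, ?_⟩
  · rw [← lintegral_lintegral_swap (μ := ν) (ν := ρ.restrict (Iio x)) hkm.aemeasurable]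
    refine le_trans ?_ (setLIntegral_le_lintegral (Iio x) _)
    refine setLIntegral_mono' measurableSet_Iio fun t ht => ?_
    rcases eq_or_ne (U t) 0 with hz | hz
    · simp [hh0 t hz]
    simp_rw [hkS]
    rw [lintegral_indicator_const (hsec t), Measure.restrict_apply (hsec t)]
    have : Prod.mk t ⁻¹' S ∩ Iio x = Prod.mk t ⁻¹' S :=
      inter_eq_left.2 fun s hs => lt_trans hs.1 ht
    rw [this, mul_assoc, ENNReal.inv_mul_cancel (hm0 t hz) (hmtop t), mul_one]
  · calc ∫⁻ s, (∫⁻ t, k t s ∂ν) * v s ∂ρ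
        = ∫⁻ s, ∫⁻ t, k t s * v s ∂ν ∂ρ := by
          refine lintegral_congr fun s => ?_
          exact (lintegral_mul_const _ hkm.of_uncurry_right).symm
      _ = ∫⁻ t, ∫⁻ s, k t s * v s ∂ρ ∂ν := by
          rw [lintegral_lintegral_swap]
          exact (hkm.comp measurable_swap |>.mul (hv.comp measurable_fst)).aemeasurable
      _ ≤ ∫⁻ t, 2 * (h t * (U t)⁻¹) ∂ν := by
          refine lintegral_mono fun t => ?_
          rcases eq_or_ne (U t) 0 with hz | hz
          · simp [hkS, hh0 t hz]
          calc ∫⁻ s, k t s * v s ∂ρ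
              ≤ ∫⁻ s, (Prod.mk t ⁻¹' S).indicator
                  (fun _ => h t * (m t)⁻¹ * (U t / 2)⁻¹) s ∂ρ := by
                refine lintegral_mono fun s => ?_
                simp only [hkS]
                by_cases hs : s ∈ Prod.mk t ⁻¹' S
                · rw [indicator_of_mem hs, indicator_of_mem hs]
                  gcongr
                  rw [ENNReal.le_inv_iff_le_inv]
                  exact hs.2.le
                · simp [indicator_of_notMem hs]
            _ = h t * (m t)⁻¹ * (U t / 2)⁻¹ * m t := lintegral_indicator_const (hsec t) _
            _ = h t * (U t / 2)⁻¹ * ((m t)⁻¹ * m t) := by ring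
            _ = 2 * (h t * (U t)⁻¹) := by
                rw [ENNReal.inv_mul_cancel (hm0 t hz) (hmtop t), mul_one,
                  ENNReal.inv_div (by simp) (by simp), div_eq_mul_inv]
                ring
      _ = _ := lintegral_const_mul _ (hh.mul hU.measurable.inv)

lemma le_rpow_of_le_mul_rpow {q : ℝ} (hq0 : 0 < q) (hq1 : q < 1) {A K : ℝ≥0∞} (hA : A ≠ ⊤)
    (h : A ≤ K * A ^ q) : A ≤ K ^ (1 / (1 - q)) := by
  rcases eq_or_ne A 0 with hz | hz
  · simp [hz]
  have hpos : A ^ q ≠ 0 := by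
    simp [ENNReal.rpow_eq_zero_iff, hz, hA]
  have hfin : A ^ q ≠ ⊤ := ENNReal.rpow_ne_top_of_nonneg hq0.le hA
  have h1 : A ^ (1 - q) ≤ K := by
    rw [← ENNReal.mul_le_mul_iff_left hpos hfin, ← ENNReal.rpow_add _ _ hz hA]
    simpa using h
  calc A = (A ^ (1 - q)) ^ (1 / (1 - q)) := by
        rw [← ENNReal.rpow_mul, mul_one_div_cancel (by linarith), ENNReal.rpow_one]
    _ ≤ _ := by
        gcongr

lemma lintegral_mul_rpow_le_of_hardy {ρ ν : Measure ℝ} [SFinite ρ] [IsFiniteMeasure ν]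
    [NullSingletonClass ν] (hρ : ∀ t, ρ (Iio t) ≠ ⊤) (hW : Continuous fun t => ν (Ioi t))
    (h0 : ν (Iic 0) = 0) {N : ℝ} (hN : ν (Ioi N) = 0) {q α : ℝ} (hq0 : 0 < q) (hq1 : q < 1)
    (hα : 0 < α) (hqα : (1 + α) * q = α) {v : ℝ → ℝ≥0∞} (hv : Measurable v) {U : ℝ → ℝ≥0∞}
    (hU : Monotone U) (hUV : ∀ t, U t ≤ essSup (fun s => (v s)⁻¹) (ρ.restrict (Iio t)))
    {M : ℝ≥0∞} (hM : M ≠ ⊤) (hUM : ∀ t, U t ≤ M) {C : ℝ≥0∞}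
    (hC : ∀ f : ℝ → ℝ≥0∞, Measurable f →
      (∫⁻ t, (∫⁻ s in Iio t, f s ∂ρ) ^ q ∂ν) ^ (1 / q) ≤ C * ∫⁻ s, f s * v s ∂ρ) :
    ∫⁻ t, (U t * ν (Ioi t)) ^ α ∂ν ≤ (2 ^ α * 4 * 4 * (C * 2) ^ q) ^ (1 / (1 - q)) := by
  have hWm : Measurable fun t => ν (Ioi t) := hW.measurable
  have hUtop : ∀ t, U t ≠ ⊤ := fun t => ((hUM t).trans_lt hM.lt_top).ne
  obtain ⟨f, hf, hf1, hf2⟩ := exists_lintegral_Iio_le (ν := ν) hρ hv hU hUV hUtop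
    (h := fun t => U t ^ (1 + α) * ν (Ioi t) ^ α)
    ((hU.measurable.pow_const _).mul (hWm.pow_const _))
    (fun t ht => by simp [ht, ENNReal.zero_rpow_of_pos (show 0 < 1 + α by linarith)])
  set A := ∫⁻ t, (U t * ν (Ioi t)) ^ α ∂ν with hA
  have hAtop : A ≠ ⊤ := by
    refine ne_top_of_le_ne_top ?_ (lintegral_mono (g := fun _ => (M * ν univ) ^ α) fun t => ?_)
    · rw [lintegral_const]
      exact ENNReal.mul_ne_top (ENNReal.rpow_ne_top_of_nonneg hα.le
        (ENNReal.mul_ne_top hM (measure_ne_top _ _))) (measure_ne_top _ _)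
    · dsimp only
      gcongr
      · exact hUM t
      · exact subset_univ _
  have hf3 : ∫⁻ s, f s * v s ∂ρ ≤ 2 * A := by
    refine hf2.trans ?_
    gcongr 2 * ?_
    refine lintegral_mono fun t => ?_
    dsimp only
    rw [ENNReal.mul_rpow_of_nonneg _ _ hα.le, mul_right_comm]
    gcongr
    rcases eq_or_ne (U t) 0 with hz | hz
    · simp [hz, ENNReal.zero_rpow_of_pos (show 0 < 1 + α by linarith)]
    · rw [add_comm, ENNReal.rpow_add _ _ hz (hUtop t), ENNReal.rpow_one, mul_assoc,
        ENNReal.mul_inv_cancel hz (hUtop t), mul_one]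
  refine le_rpow_of_le_mul_rpow hq0 hq1 hAtop ?_
  calc A ≤ 2 ^ α * 4 * 4 * ∫⁻ x, (∫⁻ t in Iio x, U t ^ (1 + α) * ν (Ioi t) ^ α ∂ν) ^ q ∂ν :=
        lintegral_mul_rpow_le hW h0 hN hq0 hα hqα hU
    _ ≤ 2 ^ α * 4 * 4 * ∫⁻ x, (∫⁻ s in Iio x, f s ∂ρ) ^ q ∂ν := by
        gcongr 2 ^ α * 4 * 4 * ?_
        exact lintegral_mono fun x => ENNReal.rpow_le_rpow (hf1 x) hq0.le
    _ = 2 ^ α * 4 * 4 * ((∫⁻ x, (∫⁻ s in Iio x, f s ∂ρ) ^ q ∂ν) ^ (1 / q)) ^ q := by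
        rw [← ENNReal.rpow_mul, one_div_mul_cancel hq0.ne', ENNReal.rpow_one]
    _ ≤ 2 ^ α * 4 * 4 * (C * (2 * A)) ^ q := by
        gcongr
        exact (hC f hf).trans (by gcongr)
    _ = _ := by
        rw [← mul_assoc C, ENNReal.mul_rpow_of_nonneg (C * 2) A hq0.le, ← mul_assoc]

lemma lintegral_rpow_le_of_lintegral_mul_rpow {ρ ν : Measure ℝ} [SFinite ρ] [IsFiniteMeasure ν]
    [NullSingletonClass ν] (hW : Continuous fun t => ν (Ioi t)) {q α : ℝ} (hq0 : 0 < q)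
    (hq1 : q < 1) (hα : 0 < α) (hqα : q / α = 1 - q) {v : ℝ → ℝ≥0∞} {V : ℝ → ℝ≥0∞}
    (hV : Monotone V) (hvV : ∀ r, ∀ᵐ s ∂ρ.restrict (Iio r), (v s)⁻¹ ≤ V r)
    (hA : ∫⁻ t, (V t * ν (Ioi t)) ^ α ∂ν ≠ ⊤) {f : ℝ → ℝ≥0∞} (hf : Measurable f) :
    ∫⁻ t, (∫⁻ s in Iio t, f s ∂ρ) ^ q ∂ν ≤
      ((2⁻¹ ^ α * 2⁻¹) ^ (-(1 / α)) * ∫⁻ s, f s * v s ∂ρ) ^ q *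
        (2 * ∫⁻ t, (V t * ν (Ioi t)) ^ α ∂ν + 1) ^ (1 - q) := by
  have hWm : Measurable fun t => ν (Ioi t) := hW.measurable
  have hφm : Measurable fun t => (V t * ν (Ioi t)) ^ α := (hV.measurable.mul hWm).pow_const α
  set A := ∫⁻ t, (V t * ν (Ioi t)) ^ α ∂ν with hAdef
  set I : ℝ → ℝ≥0∞ := fun t => ∫⁻ r in Iic t, (V r * ν (Ioi r)) ^ α * (ν (Ioi r))⁻¹ ∂ν with hI
  have hImono : Monotone I := fun x y h => lintegral_mono_set (Iic_subset_Iic.2 h)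
  set ε : ℝ≥0∞ := (1 + ν univ)⁻¹ with hε
  have hε0 : ε ≠ 0 := ENNReal.inv_ne_zero.2 (by simp)
  set G : ℝ → ℝ≥0∞ := fun t => (V t * ν (Ioi t)) ^ α + I t + ε with hG
  have hGm : Measurable G := (hφm.add hImono.measurable).add_const ε
  have hG0 : ∀ t, G t ≠ 0 := fun t h => hε0 (by simp only [hG, add_eq_zero] at h; exact h.2)
  have hIint : ∫⁻ t, I t ∂ν ≤ A := by
    have hkm : Measurable (Function.uncurry fun t r : ℝ => {p : ℝ × ℝ | p.2 ≤ p.1}.indicator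
        (fun p => (V p.2 * ν (Ioi p.2)) ^ α * (ν (Ioi p.2))⁻¹) (t, r)) :=
      Measurable.indicator ((hφm.comp measurable_snd).mul (hWm.comp measurable_snd).inv)
        (measurableSet_le measurable_snd measurable_fst)
    calc ∫⁻ t, I t ∂ν = ∫⁻ t, ∫⁻ r, {p : ℝ × ℝ | p.2 ≤ p.1}.indicator
          (fun p => (V p.2 * ν (Ioi p.2)) ^ α * (ν (Ioi p.2))⁻¹) (t, r) ∂ν ∂ν := by
          refine lintegral_congr fun t => ?_
          simp only [hI]
          rw [← lintegral_indicator measurableSet_Iic]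
          rfl
      _ = ∫⁻ r, ∫⁻ t, {p : ℝ × ℝ | p.2 ≤ p.1}.indicator
          (fun p => (V p.2 * ν (Ioi p.2)) ^ α * (ν (Ioi p.2))⁻¹) (t, r) ∂ν ∂ν :=
          lintegral_lintegral_swap hkm.aemeasurable
      _ = ∫⁻ r, (V r * ν (Ioi r)) ^ α * (ν (Ioi r))⁻¹ * ν (Ici r) ∂ν := by
          refine lintegral_congr fun r => ?_
          rw [← lintegral_indicator_const measurableSet_Ici]
          rfl
      _ ≤ A := by
          refine lintegral_mono fun r => ?_
          rw [← measure_congr (Ioi_ae_eq_Ici (μ := ν) (a := r)), mul_assoc]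
          exact mul_le_of_le_one_right' (ENNReal.inv_mul_le_one _)
  have hGint : ∫⁻ t, G t ∂ν ≤ 2 * A + 1 := by
    rw [hG, lintegral_add_right _ measurable_const, lintegral_add_left hφm, lintegral_const,
      two_mul]
    gcongr
    calc ε * ν univ ≤ ε * (1 + ν univ) := by gcongr; exact le_add_self
      _ ≤ 1 := ENNReal.inv_mul_le_one _
  have hGfin : ∀ᵐ t ∂ν, G t < ⊤ :=
    ae_lt_top hGm (ne_top_of_le_ne_top (by finiteness) hGint)
  set g : ℝ → ℝ≥0∞ := fun t => G t ^ (-(1 / α)) with hg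
  have hgm : Measurable g := hGm.pow_const _
  set K : ℝ≥0∞ := (2⁻¹ ^ α * 2⁻¹) ^ (-(1 / α)) with hK
  have hc0 : (2⁻¹ ^ α * 2⁻¹ : ℝ≥0∞) ≠ 0 := by
    simp [ENNReal.rpow_eq_zero_iff]
  have hc1 : (2⁻¹ ^ α * 2⁻¹ : ℝ≥0∞) ≠ ⊤ :=
    ENNReal.mul_ne_top (ENNReal.rpow_ne_top_of_nonneg hα.le (by simp)) (by simp)
  have htail : ∀ r, ∫⁻ t in Ioi r, g t ∂ν ≤ K * (V r)⁻¹ := by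
    intro r
    rcases eq_or_ne (ν (Ioi r)) 0 with hz | hz
    · rw [Measure.restrict_eq_zero.2 hz, lintegral_zero_measure]
      exact zero_le
    have hfin : ν (Ioi r) ≠ ⊤ := measure_ne_top _ _
    calc ∫⁻ t in Ioi r, g t ∂ν ≤ ∫⁻ _ in Ioi r, K * (V r * ν (Ioi r))⁻¹ ∂ν := by
          refine setLIntegral_mono' measurableSet_Ioi fun t ht => ?_
          have h1 : (V r * ν (Ioi r)) ^ α * (2⁻¹ ^ α * 2⁻¹) ≤ G t :=
            (mul_rpow_le_add_setLIntegral hW hα hV (le_of_lt ht)).trans le_self_add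
          have h2 : g t ≤ ((V r * ν (Ioi r)) ^ α * (2⁻¹ ^ α * 2⁻¹)) ^ (-(1 / α)) := by
            simp only [hg]
            rw [ENNReal.rpow_neg, ENNReal.rpow_neg]
            exact ENNReal.inv_le_inv.2 (ENNReal.rpow_le_rpow h1 (one_div_nonneg.2 hα.le))
          refine h2.trans (le_of_eq ?_)
          rw [hK, ENNReal.rpow_neg, ENNReal.rpow_neg,
            ENNReal.mul_rpow_of_nonneg _ _ (one_div_nonneg.2 hα.le), ← ENNReal.rpow_mul,
            mul_one_div_cancel hα.ne', ENNReal.rpow_one, mul_comm]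
          refine ENNReal.mul_inv (Or.inl ?_) (Or.inl ?_)
          · simp [ENNReal.rpow_eq_zero_iff, hc0, hc1]
          · exact ENNReal.rpow_ne_top_of_nonneg (one_div_nonneg.2 hα.le) hc1
      _ = K * (V r * ν (Ioi r))⁻¹ * ν (Ioi r) := setLIntegral_const _ _
      _ = K * (V r)⁻¹ * ((ν (Ioi r))⁻¹ * ν (Ioi r)) := by
          rw [ENNReal.mul_inv (Or.inr hfin) (Or.inr hz)]
          ring
      _ = _ := by rw [ENNReal.inv_mul_cancel hz hfin, mul_one]
  have htail' : ∀ᵐ s ∂ρ, ∫⁻ t in Ioi s, g t ∂ν ≤ K * v s := by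
    have hall : ∀ᵐ s : ℝ ∂ρ, ∀ r : ℚ, s < r → (v s)⁻¹ ≤ V r := by
      rw [ae_all_iff]
      intro r
      exact (ae_restrict_iff' measurableSet_Iio).1 (hvV r)
    filter_upwards [hall] with s hs
    have hunion : Ioi s = ⋃ r : {r : ℚ // s < r}, Ioi ((r : ℚ) : ℝ) := by
      ext t
      simp only [mem_Ioi, mem_iUnion, Subtype.exists, exists_prop]
      constructor
      · intro h
        obtain ⟨r, h1, h2⟩ := exists_rat_btwn h
        exact ⟨r, h1, h2⟩
      · rintro ⟨r, h1, h2⟩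
        exact h1.trans h2
    have hanti : Antitone fun r : {r : ℚ // s < r} => Ioi ((r : ℚ) : ℝ) :=
      fun a b h => Ioi_subset_Ioi (by exact_mod_cast h)
    rw [hunion, setLIntegral_iUnion_of_directed _ hanti.directed_le]
    refine iSup_le fun r => (htail r).trans ?_
    gcongr
    exact ENNReal.inv_le_iff_inv_le.1 (hs r r.2)
  set F : ℝ → ℝ≥0∞ := fun t => ∫⁻ s in Iio t, f s ∂ρ with hF
  have hFm : Measurable F :=
    Monotone.measurable fun x y h => lintegral_mono_set (Iio_subset_Iio h)
  have hFg : ∫⁻ t, F t * g t ∂ν ≤ K * ∫⁻ s, f s * v s ∂ρ := by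
    have hkm : Measurable (Function.uncurry fun t s : ℝ => {p : ℝ × ℝ | p.2 < p.1}.indicator
        (fun p => f p.2 * g p.1) (t, s)) :=
      Measurable.indicator ((hf.comp measurable_snd).mul (hgm.comp measurable_fst))
        (measurableSet_lt measurable_snd measurable_fst)
    calc ∫⁻ t, F t * g t ∂ν = ∫⁻ t, ∫⁻ s, {p : ℝ × ℝ | p.2 < p.1}.indicator
          (fun p => f p.2 * g p.1) (t, s) ∂ρ ∂ν := by
          refine lintegral_congr fun t => ?_
          rw [hF, ← lintegral_mul_const _ hf, ← lintegral_indicator measurableSet_Iio]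
          rfl
      _ = ∫⁻ s, ∫⁻ t, {p : ℝ × ℝ | p.2 < p.1}.indicator
          (fun p => f p.2 * g p.1) (t, s) ∂ν ∂ρ := lintegral_lintegral_swap hkm.aemeasurable
      _ = ∫⁻ s, f s * ∫⁻ t in Ioi s, g t ∂ν ∂ρ := by
          refine lintegral_congr fun s => ?_
          rw [← lintegral_const_mul _ hgm, ← lintegral_indicator measurableSet_Ioi]
          rfl
      _ ≤ ∫⁻ s, K * (f s * v s) ∂ρ := by
          refine lintegral_mono_ae ?_
          filter_upwards [htail'] with s hs
          rw [mul_left_comm]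
          gcongr
      _ = _ := by
          refine lintegral_const_mul' _ _ ?_
          exact ENNReal.rpow_ne_top_of_ne_zero hc0 hc1
  calc ∫⁻ t, F t ^ q ∂ν = ∫⁻ t, (F t * g t) ^ q * G t ^ (1 - q) ∂ν := by
        refine lintegral_congr_ae ?_
        filter_upwards [hGfin] with t ht
        rw [ENNReal.mul_rpow_of_nonneg _ _ hq0.le, mul_assoc, hg, ← ENNReal.rpow_mul,
          ← ENNReal.rpow_add _ _ (hG0 t) ht.ne,
          show -(1 / α) * q + (1 - q) = 0 by rw [← hqα]; ring, ENNReal.rpow_zero, mul_one]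
    _ ≤ (∫⁻ t, F t * g t ∂ν) ^ q * (∫⁻ t, G t ∂ν) ^ (1 - q) :=
        ENNReal.lintegral_mul_norm_pow_le (hFm.mul hgm).aemeasurable hGm.aemeasurable hq0.le
          (by linarith) (by ring)
    _ ≤ _ := by
        gcongr

/-- The density `w` on `(0, ∞)`, truncated to a bounded function with bounded support. -/
noncomputable def truncDensity (w : ℝ → ℝ≥0∞) (n : ℕ) : ℝ → ℝ≥0∞ :=
  (Iio (n : ℝ)).indicator fun t => min (w t) n

/-- The finite measure on `(0, ∞)` with density `truncDensity w n`. -/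
noncomputable def truncMeasure (w : ℝ → ℝ≥0∞) (n : ℕ) : Measure ℝ :=
  (volume.restrict (Ioi 0)).withDensity (truncDensity w n)

lemma measurable_truncDensity {w : ℝ → ℝ≥0∞} (hw : Measurable w) (n : ℕ) :
    Measurable (truncDensity w n) :=
  (hw.min measurable_const).indicator measurableSet_Iio

lemma truncDensity_le (w : ℝ → ℝ≥0∞) (n : ℕ) (t : ℝ) : truncDensity w n t ≤ n :=
  indicator_le' (fun _ _ => min_le_right _ _) (fun _ _ => zero_le) t

lemma monotone_truncDensity (w : ℝ → ℝ≥0∞) (t : ℝ) : Monotone fun n => truncDensity w n t := by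
  intro m n hmn
  have h : (m : ℝ) ≤ n := by exact_mod_cast hmn
  simp only [truncDensity]
  refine (indicator_le_indicator (g := fun t => min (w t) n) ?_).trans
    (indicator_le_indicator_of_subset (Iio_subset_Iio h) (fun _ => zero_le) t)
  gcongr

lemma iSup_truncDensity (w : ℝ → ℝ≥0∞) (t : ℝ) : ⨆ n, truncDensity w n t = w t := by
  refine le_antisymm (iSup_le fun n => ?_) ?_
  · exact indicator_le' (fun _ _ => min_le_left _ _) (fun _ _ => zero_le) t
  · obtain ⟨n, hn⟩ := exists_nat_gt t
    calc w t = ⨆ m : ℕ, min (w t) m := by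
          rw [← inf_iSup_eq, ENNReal.iSup_natCast, inf_top_eq]
      _ ≤ _ := iSup_le fun m => le_iSup_of_le (max m n) ?_
    have hmem : t ∈ Iio ((max m n : ℕ) : ℝ) :=
      hn.trans_le (by exact_mod_cast le_max_right m n)
    rw [truncDensity, indicator_of_mem hmem]
    gcongr
    exact le_max_left m n

lemma truncMeasure_le (w : ℝ → ℝ≥0∞) (n : ℕ) {s : Set ℝ} (hs : MeasurableSet s) :
    truncMeasure w n s ≤ n * volume s := by
  rw [truncMeasure, withDensity_apply _ hs]
  calc ∫⁻ t in s, truncDensity w n t ∂volume.restrict (Ioi 0)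
      ≤ ∫⁻ _ in s, n ∂volume.restrict (Ioi 0) := lintegral_mono fun t => truncDensity_le w n t
    _ = n * volume.restrict (Ioi 0) s := setLIntegral_const _ _
    _ ≤ _ := by
        gcongr
        exact Measure.restrict_le_self

lemma truncMeasure_Ioi_self (w : ℝ → ℝ≥0∞) (n : ℕ) : truncMeasure w n (Ioi n) = 0 := by
  rw [truncMeasure, withDensity_apply _ measurableSet_Ioi]
  refine (setLIntegral_congr_fun measurableSet_Ioi fun t ht => ?_).trans lintegral_zero
  have h : t ∉ Iio (n : ℝ) := not_lt.2 (le_of_lt (mem_Ioi.1 ht))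
  simp [truncDensity, indicator_of_notMem h]

lemma truncMeasure_Iic_zero (w : ℝ → ℝ≥0∞) (n : ℕ) : truncMeasure w n (Iic 0) = 0 := by
  refine withDensity_absolutelyContinuous _ _ ?_
  rw [Measure.restrict_apply measurableSet_Iic, Iic_inter_Ioi, Ioc_self, measure_empty]

instance (w : ℝ → ℝ≥0∞) (n : ℕ) : IsFiniteMeasure (truncMeasure w n) := by
  refine ⟨?_⟩
  have hsub : (univ : Set ℝ) ⊆ Iic 0 ∪ (Ioc 0 (n : ℝ) ∪ Ioi (n : ℝ)) := by
    intro x _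
    rcases le_or_gt x 0 with h | h
    · exact Or.inl h
    · rcases le_or_gt x n with h' | h'
      · exact Or.inr (Or.inl ⟨h, h'⟩)
      · exact Or.inr (Or.inr h')
  calc truncMeasure w n univ ≤ truncMeasure w n (Iic 0) +
        (truncMeasure w n (Ioc 0 n) + truncMeasure w n (Ioi n)) :=
        (measure_mono hsub).trans ((measure_union_le _ _).trans
          (by gcongr; exact measure_union_le _ _))
    _ ≤ n * volume (Ioc (0 : ℝ) n) := by
        rw [truncMeasure_Iic_zero, truncMeasure_Ioi_self, zero_add, add_zero]
        exact truncMeasure_le w n measurableSet_Ioc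
    _ < ⊤ := ENNReal.mul_lt_top (by simp) (by simp)

instance (w : ℝ → ℝ≥0∞) (n : ℕ) : NullSingletonClass (truncMeasure w n) :=
  ⟨fun x => withDensity_absolutelyContinuous _ _ (measure_singleton x)⟩

lemma continuous_truncMeasure_Ioi (w : ℝ → ℝ≥0∞) (n : ℕ) :
    Continuous fun t => truncMeasure w n (Ioi t) := by
  refine continuous_of_le_add_edist (n : ℝ≥0∞) (by simp) fun s t => ?_
  rcases le_total t s with h | h
  · exact le_add_right (antitone_measure_Ioi _ h)
  · rw [← measure_Ioc_add_measure_Ioi _ h, add_comm]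
    gcongr
    refine (truncMeasure_le w n measurableSet_Ioc).trans (le_of_eq ?_)
    rw [Real.volume_Ioc, edist_dist, dist_comm, Real.dist_eq, abs_of_nonneg (sub_nonneg.2 h)]

lemma iSup_mul_iSup_of_monotone {a b : ℕ → ℝ≥0∞} (ha : Monotone a) (hb : Monotone b) :
    (⨆ n, a n) * ⨆ n, b n = ⨆ n, a n * b n := by
  refine le_antisymm ?_ ENNReal.iSup_mul_le
  simp_rw [ENNReal.iSup_mul, ENNReal.mul_iSup]
  exact iSup_le fun i => iSup_le fun j => le_iSup_of_le (max i j)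
    (mul_le_mul' (ha (le_max_left i j)) (hb (le_max_right i j)))

lemma iSup_rpow {α : ℝ} (hα : 0 < α) (a : ℕ → ℝ≥0∞) : (⨆ n, a n) ^ α = ⨆ n, a n ^ α :=
  (ENNReal.orderIsoRpow α hα).map_iSup a

lemma iSup_lintegral_truncMeasure {w : ℝ → ℝ≥0∞} (hw : Measurable w) {g : ℕ → ℝ → ℝ≥0∞}
    (hg : ∀ n, Measurable (g n)) (hmono : ∀ t, Monotone fun n => g n t) :
    ⨆ n, ∫⁻ t, g n t ∂truncMeasure w n = ∫⁻ t in Ioi 0, (⨆ n, g n t) * w t := by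
  calc ⨆ n, ∫⁻ t, g n t ∂truncMeasure w n
      = ⨆ n, ∫⁻ t in Ioi 0, g n t * truncDensity w n t := by
        congr with n
        rw [truncMeasure, lintegral_withDensity_eq_lintegral_mul _ (measurable_truncDensity hw n)
          (hg n)]
        exact lintegral_congr fun t => mul_comm _ _
    _ = ∫⁻ t in Ioi 0, ⨆ n, g n t * truncDensity w n t := by
        refine (lintegral_iSup (fun n => (hg n).mul (measurable_truncDensity hw n)) ?_).symm
        exact fun m n h t => mul_le_mul' (hmono t h) (monotone_truncDensity w t h)
    _ = _ := by
        refine lintegral_congr fun t => ?_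
        rw [← iSup_mul_iSup_of_monotone (hmono t) (monotone_truncDensity w t),
          iSup_truncDensity]

lemma monotone_truncMeasure (w : ℝ → ℝ≥0∞) (s : Set ℝ) : Monotone fun n => truncMeasure w n s :=
  fun _ _ h => withDensity_mono (ae_of_all _ fun t => monotone_truncDensity w t h) s

lemma iSup_truncMeasure_Ioi {w : ℝ → ℝ≥0∞} (hw : Measurable w) {t : ℝ} (ht : 0 ≤ t) :
    ⨆ n, truncMeasure w n (Ioi t) = ∫⁻ s in Ioi t, w s := by
  have h := iSup_lintegral_truncMeasure hw (g := fun _ => (Ioi t).indicator 1)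
    (fun _ => measurable_one.indicator measurableSet_Ioi) (fun _ _ _ _ => le_rfl)
  simp only [lintegral_indicator_one measurableSet_Ioi, ciSup_const] at h
  rw [h]
  calc ∫⁻ s in Ioi 0, (Ioi t).indicator 1 s * w s
      = ∫⁻ s in Ioi 0, (Ioi t).indicator w s := by
        refine lintegral_congr fun s => ?_
        by_cases hs : s ∈ Ioi t <;> simp [hs]
    _ = _ := by
        rw [setLIntegral_indicator measurableSet_Ioi,
          inter_eq_left.2 (Ioi_subset_Ioi ht)]

/-- The two-weight Hardy inequality, non-convex case `p = 1`, `0 < q < 1`: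
the inequality holds with some positive constant `C` for all nonnegative
measurable `f` iff `∫_0^∞ V(t)^{q/(1-q)} W(t)^{q/(1-q)} w(t) dt < ∞`, where
`V(t) = ess sup_{s∈(0,t)} 1/v(s)` and `W(t) = ∫_t^∞ w`. -/
theorem hardy_nonconvex_case_p_eq_one (q : ℝ) (hq0 : 0 < q) (hq1 : q < 1)
    (v w : ℝ → ℝ≥0∞) (hv : Measurable v) (hw : Measurable w) :
    (∃ C : ℝ, 0 < C ∧ ∀ f : ℝ → ℝ≥0∞, Measurable f →
        (∫⁻ t in Ioi (0 : ℝ), (∫⁻ s in Ioo 0 t, f s) ^ q * w t) ^ (1 / q) ≤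
          ENNReal.ofReal C * ∫⁻ s in Ioi (0 : ℝ), f s * v s) ↔
    (∫⁻ t in Ioi (0 : ℝ),
        (essSup (fun s => (v s)⁻¹) (volume.restrict (Ioo (0 : ℝ) t))) ^ (q / (1 - q)) *
          (∫⁻ s in Ioi t, w s) ^ (q / (1 - q)) * w t) < ⊤ := by
  set α := q / (1 - q) with hαdef
  have h1q : 0 < 1 - q := by linarith
  have hα : 0 < α := div_pos hq0 h1q
  have hqα : (1 + α) * q = α := by rw [hαdef]; field_simp; ring
  have hqα' : q / α = 1 - q := by rw [hαdef]; field_simp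
  set ρ : Measure ℝ := volume.restrict (Ioi 0) with hρdef
  have hρ : ∀ t, ρ.restrict (Iio t) = volume.restrict (Ioo 0 t) := fun t => by
    rw [hρdef, Measure.restrict_restrict measurableSet_Iio, inter_comm, Ioi_inter_Iio]
  set V : ℝ → ℝ≥0∞ := fun t => essSup (fun s => (v s)⁻¹) (ρ.restrict (Iio t)) with hVdef
  have hV : Monotone V := fun x y h =>
    essSup_mono_measure' (Measure.restrict_mono (Iio_subset_Iio h) le_rfl)
  have hρtop : ∀ t, ρ (Iio t) ≠ ⊤ := fun t => by
    rw [hρdef, Measure.restrict_apply measurableSet_Iio, inter_comm, Ioi_inter_Iio]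
    simp
  have hlim : ∀ U : ℕ → ℝ → ℝ≥0∞, (∀ n, Measurable (U n)) → (∀ t, Monotone fun n => U n t) →
      (∀ t, ⨆ n, U n t = V t) →
      ⨆ n, ∫⁻ t, (U n t * truncMeasure w n (Ioi t)) ^ α ∂truncMeasure w n =
        ∫⁻ t in Ioi 0, V t ^ α * (∫⁻ s in Ioi t, w s) ^ α * w t := by
    intro U hUm hUmono hUsup
    rw [iSup_lintegral_truncMeasure hw
      (g := fun n t => (U n t * truncMeasure w n (Ioi t)) ^ α)
      (fun n => ((hUm n).mul (continuous_truncMeasure_Ioi w n).measurable).pow_const α)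
      (fun t m n h => ENNReal.rpow_le_rpow
        (mul_le_mul' (hUmono t h) (monotone_truncMeasure w _ h)) hα.le)]
    refine setLIntegral_congr_fun measurableSet_Ioi fun t ht => ?_
    rw [← iSup_rpow hα, ← iSup_mul_iSup_of_monotone (hUmono t) (monotone_truncMeasure w _),
      hUsup, iSup_truncMeasure_Ioi hw (le_of_lt ht), ENNReal.mul_rpow_of_nonneg _ _ hα.le]
  have hFm : ∀ f : ℝ → ℝ≥0∞, Measurable fun t => (∫⁻ s in Iio t, f s ∂ρ) ^ q := fun f =>
    Measurable.pow_const (Monotone.measurable fun x y h =>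
      lintegral_mono_set (Iio_subset_Iio h)) q
  have hlhs : ∀ f : ℝ → ℝ≥0∞, ⨆ n, ∫⁻ t, (∫⁻ s in Iio t, f s ∂ρ) ^ q ∂truncMeasure w n =
      ∫⁻ t, (∫⁻ s in Iio t, f s ∂ρ) ^ q * w t ∂ρ := by
    intro f
    rw [iSup_lintegral_truncMeasure hw (fun _ => hFm f) (fun _ _ _ _ => le_rfl)]
    simp only [ciSup_const, hρdef]
  simp_rw [← hρ]
  constructor
  · rintro ⟨C, -, hC⟩
    simp_rw [← hlhs] at hC
    rw [← hlim (fun n t => min (V t) n) (fun n => hV.measurable.min measurable_const)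
      (fun t m n h => by dsimp only; gcongr)
      (fun t => by rw [← inf_iSup_eq, ENNReal.iSup_natCast, inf_top_eq])]
    refine lt_of_le_of_lt (iSup_le fun n => lintegral_mul_rpow_le_of_hardy hρtop
      (continuous_truncMeasure_Ioi w n) (truncMeasure_Iic_zero w n) (truncMeasure_Ioi_self w n)
      hq0 hq1 hα hqα hv (fun x y h => min_le_min_right _ (hV h)) (fun t => min_le_left _ _)
      (M := n) (by simp) (fun t => min_le_right _ _) (C := ENNReal.ofReal C)
      fun f hf => le_trans ?_ (hC f hf)) ?_
    · gcongr
      exact le_iSup (fun n => ∫⁻ t, (∫⁻ s in Iio t, f s ∂ρ) ^ q ∂truncMeasure w n) n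
    · refine ENNReal.rpow_lt_top_of_nonneg (one_div_nonneg.2 h1q.le) ?_
      refine ENNReal.mul_ne_top (ENNReal.mul_ne_top (ENNReal.mul_ne_top
        (ENNReal.rpow_ne_top_of_nonneg hα.le (by simp)) (by simp)) (by simp))
        (ENNReal.rpow_ne_top_of_nonneg hq0.le (ENNReal.mul_ne_top (by simp) (by simp)))
  · intro hA
    rw [← hlim (fun _ => V) (fun _ => hV.measurable) (fun _ _ _ _ => le_rfl)
      (fun _ => ciSup_const)] at hA
    set A := ⨆ n, ∫⁻ t, (V t * truncMeasure w n (Ioi t)) ^ α ∂truncMeasure w n with hAdef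
    set K : ℝ≥0∞ := (2⁻¹ ^ α * 2⁻¹) ^ (-(1 / α)) with hK
    have hKtop : K ≠ ⊤ := by
      refine ENNReal.rpow_ne_top_of_ne_zero (by simp [ENNReal.rpow_eq_zero_iff]) ?_
      exact ENNReal.mul_ne_top (ENNReal.rpow_ne_top_of_nonneg hα.le (by simp)) (by simp)
    set B : ℝ≥0∞ := K * ((2 * A + 1) ^ (1 - q)) ^ (1 / q) with hB
    have hBtop : B ≠ ⊤ := ENNReal.mul_ne_top hKtop
      (ENNReal.rpow_ne_top_of_nonneg (one_div_nonneg.2 hq0.le)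
        (ENNReal.rpow_ne_top_of_nonneg h1q.le (by finiteness)))
    refine ⟨B.toReal + 1, by positivity, fun f hf => ?_⟩
    have hBle : B ≤ ENNReal.ofReal (B.toReal + 1) := by
      rw [ENNReal.le_ofReal_iff_toReal_le hBtop (by positivity)]
      linarith
    simp_rw [← hlhs]
    calc (⨆ n, ∫⁻ t, (∫⁻ s in Iio t, f s ∂ρ) ^ q ∂truncMeasure w n) ^ (1 / q)
        ≤ ((K * ∫⁻ s, f s * v s ∂ρ) ^ q * (2 * A + 1) ^ (1 - q)) ^ (1 / q) := by
          gcongr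
          refine iSup_le fun n => ?_
          have hAn : ∫⁻ t, (V t * truncMeasure w n (Ioi t)) ^ α ∂truncMeasure w n ≤ A :=
            le_iSup (fun n => ∫⁻ t, (V t * truncMeasure w n (Ioi t)) ^ α ∂truncMeasure w n) n
          refine (lintegral_rpow_le_of_lintegral_mul_rpow (continuous_truncMeasure_Ioi w n) hq0
            hq1 hα hqα' hV (fun r => ENNReal.ae_le_essSup _) (hAn.trans_lt hA).ne hf).trans ?_
          gcongr
      _ = B * ∫⁻ s, f s * v s ∂ρ := by
          rw [ENNReal.mul_rpow_of_nonneg _ _ (one_div_nonneg.2 hq0.le), ← ENNReal.rpow_mul,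
            mul_one_div_cancel hq0.ne', ENNReal.rpow_one, hB]
          ring
      _ ≤ _ := by gcongr
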